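/- arXiv:1012.3695 — 7 statements merged into one kernel-verified Lean document; each statement's English description precedes it below -/
import Mathlib

section
/- Let N ≥ 2, let H₀ be an N×N real symmetric matrix having N distinct (real) eigenvalues, and fix k with 1 ≤ k ≤ N. Then there exists an external symmetry — a Hermitian N×N complex matrix S commuting with both H₀ and E_k that is not a complex scalar multiple of the identity matrix — if and only if H₀ has an eigenvector with vanishing k-th entry, i.e. there exist λ ∈ ℝ and a nonzero v ∈ ℝ^N with H₀ v = λ v and v_k = 0. -/
open Matrix

/-- `Ek N k` : the N×N complex matrix with (k,k) entry 1 (1-based index k)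
and all other entries 0 — the single-excitation restriction of a local Z
control on spin k. -/
def Ek (N k : ℕ) : Matrix (Fin N) (Fin N) ℂ :=
  Matrix.of fun i j => if (i : ℕ) + 1 = k ∧ (j : ℕ) + 1 = k then 1 else 0

/-- A matrix that kills a family of eigenvectors of `A` with pairwise distinct eigenvalues, indexed
by the full index type, is zero. -/
theorem Matrix.eq_zero_of_mulVec_eigenvectors_eq_zero {n K : Type*} [Fintype n] [DecidableEq n]
    [Field K] (A T : Matrix n n K) (d : n → K) (hd : Function.Injective d) (v : n → n → K)
    (hv : ∀ i, v i ≠ 0) (hA : ∀ i, A *ᵥ v i = d i • v i) (hT : ∀ i, T *ᵥ v i = 0) : T = 0 := by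
  have hli : LinearIndependent K v :=
    Module.End.eigenvectors_linearIndependent' (Matrix.toLin' A) d hd v fun i =>
      ⟨Module.End.mem_eigenspace_iff.mpr (by rw [Matrix.toLin'_apply, hA]), hv i⟩
  have hunit : IsUnit (Matrix.of v) := Matrix.linearIndependent_rows_iff_isUnit.mp hli
  have hmul : T * (Matrix.of v)ᵀ = 0 := by
    ext i j
    exact congrFun (hT j) i
  have hunit' : IsUnit (Matrix.of v)ᵀ := (Matrix.isUnit_transpose _).mpr hunit
  exact hunit'.mul_left_eq_zero.mp hmul

/-- If no real eigenvector of the real matrix `H` vanishes at `a`, then neither does any complex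
eigenvector for a real eigenvalue. -/
theorem Matrix.eq_zero_of_map_ofReal_mulVec_eq {n : Type*} [Fintype n] (H : Matrix n n ℝ) (a : n)
    (h : ∀ (l : ℝ) (v : n → ℝ), H *ᵥ v = l • v → v a = 0 → v = 0)
    (l : ℝ) (w : n → ℂ) (hw : H.map Complex.ofReal *ᵥ w = (l : ℂ) • w) (ha : w a = 0) :
    w = 0 := by
  have hre : (fun i => (w i).re) = 0 := h l _ (by
    ext i
    simpa [Matrix.mulVec, dotProduct] using congrArg Complex.re (congrFun hw i)) (by simp [ha])
  have him : (fun i => (w i).im) = 0 := h l _ (by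
    ext i
    simpa [Matrix.mulVec, dotProduct] using congrArg Complex.im (congrFun hw i)) (by simp [ha])
  ext i
  exact Complex.ext (congrFun hre i) (congrFun him i)

theorem Ek_eq_single (N k : ℕ) (a : Fin N) (ha : (a : ℕ) + 1 = k) :
    Ek N k = Matrix.single a a 1 := by
  ext i j
  simp only [Ek, Matrix.of_apply, Matrix.single_apply, Fin.ext_iff]
  congr 1
  apply propext
  omega

/-- An external symmetry (a Hermitian matrix, commuting with both `H₀` and
`E_k`, that is not a scalar multiple of the identity) exists iff `H₀` has an
eigenvector whose k-th entry vanishes. -/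
theorem stmt_0 (N : ℕ) (hN : 2 ≤ N)
    (H0 : Matrix (Fin N) (Fin N) ℝ) (hsymm : H0.IsSymm)
    (hdist : ∃ d : Fin N → ℝ, Function.Injective d ∧
      ∀ i : Fin N, ∃ v : Fin N → ℝ, v ≠ 0 ∧ H0.mulVec v = d i • v)
    (k : ℕ) (hk1 : 1 ≤ k) (hkN : k ≤ N) :
    (∃ S : Matrix (Fin N) (Fin N) ℂ, S.IsHermitian ∧
      (H0.map Complex.ofReal) * S = S * (H0.map Complex.ofReal) ∧
      (Ek N k) * S = S * (Ek N k) ∧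
      ∀ c : ℂ, S ≠ c • (1 : Matrix (Fin N) (Fin N) ℂ)) ↔
    (∃ (lam : ℝ) (v : Fin N → ℝ), v ≠ 0 ∧ H0.mulVec v = lam • v ∧
      v ⟨k - 1, by omega⟩ = 0) := by
  have hEk := Ek_eq_single N k ⟨k - 1, by omega⟩ (by simp only; omega)
  generalize (⟨k - 1, by omega⟩ : Fin N) = a at hEk ⊢
  rw [hEk]
  constructor
  · rintro ⟨S, -, hHS, hES, hS⟩
    by_contra hno
    have h : ∀ (l : ℝ) (v : Fin N → ℝ), H0 *ᵥ v = l • v → v a = 0 → v = 0 := by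
      intro l v hv hva
      by_contra hv0
      exact hno ⟨l, v, hv0, hv, hva⟩
    obtain ⟨d, hd, hex⟩ := hdist
    choose v hv0 hv using hex
    have hrow : ∀ j, (S - S a a • (1 : Matrix (Fin N) (Fin N) ℂ)) a j = 0 := by
      intro j
      by_cases hj : a = j
      · subst hj
        simp
      · have := congrFun (congrFun hES a) j
        simp [Ne.symm hj] at this
        simp [this, hj]
    have hcomm : H0.map Complex.ofReal * (S - S a a • (1 : Matrix (Fin N) (Fin N) ℂ)) =
        (S - S a a • (1 : Matrix (Fin N) (Fin N) ℂ)) * H0.map Complex.ofReal := by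
      simp [mul_sub, sub_mul, hHS]
    have hveig : ∀ i, H0.map Complex.ofReal *ᵥ (fun j => (v i j : ℂ)) =
        (d i : ℂ) • fun j => (v i j : ℂ) := by
      intro i
      ext j
      simpa [Matrix.mulVec, dotProduct] using congrArg Complex.ofReal (congrFun (hv i) j)
    refine hS (S a a) (sub_eq_zero.mp ?_)
    refine Matrix.eq_zero_of_mulVec_eigenvectors_eq_zero (H0.map Complex.ofReal) _
      (fun i => (d i : ℂ)) (Complex.ofReal_injective.comp hd) (fun i j => (v i j : ℂ)) ?_ hveig ?_
    · intro i hi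
      exact hv0 i (funext fun j => Complex.ofReal_eq_zero.mp (congrFun hi j))
    · intro i
      refine Matrix.eq_zero_of_map_ofReal_mulVec_eq H0 a h (d i) _ ?_ ?_
      · rw [Matrix.mulVec_mulVec, hcomm, ← Matrix.mulVec_mulVec, hveig, Matrix.mulVec_smul]
      · rw [Matrix.mulVec, dotProduct]
        exact Finset.sum_eq_zero fun j _ => by rw [hrow, zero_mul]
  · rintro ⟨l, v, hv0, hv, hva⟩
    have hleft : H0 * Matrix.vecMulVec v v = l • Matrix.vecMulVec v v := by
      rw [Matrix.mul_vecMulVec, hv, Matrix.smul_vecMulVec]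
    have hright : Matrix.vecMulVec v v * H0 = l • Matrix.vecMulVec v v := by
      rw [Matrix.vecMulVec_mul, ← Matrix.mulVec_transpose, hsymm.eq, hv, Matrix.vecMulVec_smul]
    refine ⟨(Matrix.vecMulVec v v).map Complex.ofRealHom, ?_, ?_, ?_, ?_⟩
    · ext i j
      simp [Matrix.vecMulVec_apply, mul_comm]
    · change H0.map Complex.ofRealHom * _ = _ * H0.map Complex.ofRealHom
      rw [← Matrix.map_mul, ← Matrix.map_mul, hleft, hright]
    · ext i j
      by_cases hi : i = a <;> by_cases hj : j = a <;>
        simp [hi, hj, Matrix.vecMulVec_apply, hva]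
    · intro c hc
      have hc0 : c = 0 := by
        simpa [Matrix.vecMulVec_apply, hva] using (congrFun (congrFun hc a) a).symm
      refine hv0 (funext fun i => ?_)
      simpa [Matrix.vecMulVec_apply, hc0] using congrFun (congrFun hc i) i
end

section
/- Let N ≥ 3 and 1 ≤ k ≤ N, and let H̄₁ = E_k − (1/N)·I be the traceless part of the control Hamiltonian E_k. Then the only N×N complex matrix S satisfying H̄₁ S + S H̄₁ = 0 is S = 0. In particular there is no unitary matrix S satisfying the internal-symmetry conditions H̄₀ᵀS + SH̄₀ = 0 and H̄₁ᵀS + SH̄₁ = 0 for any traceless H̄₀, so an XXZ network with a single-node Z control admits no internal symmetries on the single-excitation subspace. -/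
open Matrix

/-- A matrix anticommuting with a diagonal matrix no two of whose entries sum to zero vanishes. -/
theorem Matrix.eq_zero_of_diagonal_anticommute {n R : Type*} [Fintype n] [DecidableEq n]
    [CommRing R] [NoZeroDivisors R] {d : n → R} (hd : ∀ i j, d i + d j ≠ 0) {S : Matrix n n R}
    (h : diagonal d * S + S * diagonal d = 0) : S = 0 := by
  ext i j
  have hij := congrFun (congrFun h i) j
  simp only [add_apply, diagonal_mul, mul_diagonal, zero_apply] at hij
  refine (mul_eq_zero.mp (?_ : (d i + d j) * S i j = 0)).resolve_left (hd i j)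
  linear_combination hij

theorem Ek_sub_smul_one_eq_diagonal (N k : ℕ) (c : ℂ) :
    Ek N k - c • 1 = diagonal fun i : Fin N => (if (i : ℕ) + 1 = k then 1 else 0) - c := by
  ext i j
  by_cases hij : i = j
  · subst hij
    simp [Ek]
  · have : ¬ ((i : ℕ) + 1 = k ∧ (j : ℕ) + 1 = k) := fun h => hij (Fin.ext (by omega))
    simp [Ek, hij, this]

theorem eq_zero_of_anticommute_Ek {N : ℕ} (hN : 3 ≤ N) (k : ℕ) {S : Matrix (Fin N) (Fin N) ℂ}
    (h : (Ek N k - (N : ℂ)⁻¹ • 1) * S + S * (Ek N k - (N : ℂ)⁻¹ • 1) = 0) : S = 0 := by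
  rw [Ek_sub_smul_one_eq_diagonal] at h
  refine eq_zero_of_diagonal_anticommute (fun i j hij => ?_) h
  have hN0 : (N : ℂ) ≠ 0 := Nat.cast_ne_zero.mpr (by omega)
  have hN1 : (N : ℂ) ≠ 1 := by exact_mod_cast (by omega : N ≠ 1)
  have hN2 : (N : ℂ) ≠ 2 := by exact_mod_cast (by omega : N ≠ 2)
  have hinv : (N : ℂ) * (N : ℂ)⁻¹ = 1 := mul_inv_cancel₀ hN0
  split_ifs at hij
  · exact hN1 (by linear_combination (N : ℂ) / 2 * hij + hinv)
  · exact hN2 (by linear_combination (N : ℂ) * hij + 2 * hinv)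
  · exact hN2 (by linear_combination (N : ℂ) * hij + 2 * hinv)
  · exact hN0 (by linear_combination (-(N : ℂ) ^ 2 / 2) * hij - (N : ℂ) * hinv)

/-- The only matrix `S` anticommuting with the traceless part
`H̄₁ = E_k - (1/N)·I` of a single-node Z control is `S = 0`; in particular no
unitary internal symmetry exists for any traceless `H̄₀`. -/
theorem stmt_1 (N k : ℕ) (hN : 3 ≤ N) (hk1 : 1 ≤ k) (hkN : k ≤ N) :
    (∀ S : Matrix (Fin N) (Fin N) ℂ,
      (Ek N k - (N : ℂ)⁻¹ • 1) * S + S * (Ek N k - (N : ℂ)⁻¹ • 1) = 0 → S = 0) ∧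
    (∀ H0bar : Matrix (Fin N) (Fin N) ℂ, H0bar.trace = 0 →
      ¬ ∃ S : Matrix (Fin N) (Fin N) ℂ, S ∈ Matrix.unitaryGroup (Fin N) ℂ ∧
        H0bar.transpose * S + S * H0bar = 0 ∧
        (Ek N k - (N : ℂ)⁻¹ • 1).transpose * S
          + S * (Ek N k - (N : ℂ)⁻¹ • 1) = 0) := by
  refine ⟨fun S hS => eq_zero_of_anticommute_Ek hN k hS, ?_⟩
  rintro H0bar - ⟨S, hS, -, h1⟩
  have : NeZero N := ⟨by omega⟩
  rw [Ek_sub_smul_one_eq_diagonal, diagonal_transpose, ← Ek_sub_smul_one_eq_diagonal] at h1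
  have hS0 := eq_zero_of_anticommute_Ek hN k h1
  have hSS := mem_unitaryGroup_iff.mp hS
  rw [hS0, zero_mul] at hSS
  exact zero_ne_one hSS
end

section
/- Let N ≥ 3 be odd and let H₀ be the N×N real symmetric tridiagonal matrix with zero diagonal and nonzero off-diagonal entries γ₁,…,γ_{N−1} (an XX chain with arbitrary coupling strengths). Then there exists a nonzero vector v ∈ ℝ^N with H₀ v = 0 whose entries v_m vanish for every even index m. In particular, for every even k the matrix H₀ has an eigenvector with vanishing k-th entry, so an XX chain of odd length with a Z control at an even-indexed spin always has an external symmetry on the single-excitation subspace. -/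
open Matrix

/-- Single-excitation Hamiltonian of an XX chain with arbitrary couplings:
N×N tridiagonal matrix with off-diagonal entries
`(H₀)_{n,n+1} = (H₀)_{n+1,n} = γ n` (1-based, `1 ≤ n ≤ N-1`) and zero
diagonal. -/
def H0XX (N : ℕ) (γ : ℕ → ℝ) : Matrix (Fin N) (Fin N) ℝ :=
  Matrix.of fun i j =>
    if (i : ℕ) + 1 = (j : ℕ) then γ ((i : ℕ) + 1)
    else if (j : ℕ) + 1 = (i : ℕ) then γ ((j : ℕ) + 1)
    else 0

/-- The zero-mode recursion of the XX chain (0-based): `w 0 = 1`, `w 1 = 0` and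
`γ (n + 1) * w n + γ (n + 2) * w (n + 2) = 0`. -/
noncomputable def zeroMode (γ : ℕ → ℝ) : ℕ → ℝ
  | 0 => 1
  | 1 => 0
  | n + 2 => -(γ (n + 1) / γ (n + 2)) * zeroMode γ n

theorem zeroMode_of_odd (γ : ℕ → ℝ) {n : ℕ} (hn : Odd n) : zeroMode γ n = 0 := by
  obtain ⟨k, rfl⟩ := hn
  induction k with
  | zero => rfl
  | succ k ih =>
    change -(γ (2 * k + 1 + 1) / γ (2 * k + 1 + 2)) * zeroMode γ (2 * k + 1) = 0
    rw [ih, mul_zero]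

theorem zeroMode_recurrence (γ : ℕ → ℝ) {n : ℕ} (hn : γ (n + 2) ≠ 0) :
    γ (n + 1) * zeroMode γ n + γ (n + 2) * zeroMode γ (n + 2) = 0 := by
  rw [zeroMode]
  field_simp
  ring

/-- Each row of the chain Hamiltonian couples a site to its two neighbours. -/
theorem H0XX_mulVec_apply (N : ℕ) (γ w : ℕ → ℝ) (i : Fin N) :
    (H0XX N γ).mulVec (fun j => w j) i =
      (if (i : ℕ) + 1 < N then γ (i + 1) * w (i + 1) else 0) +
        (if 0 < (i : ℕ) then γ i * w (i - 1) else 0) := by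
  have hentry (j : Fin N) : H0XX N γ i j * w j =
      (if (i : ℕ) + 1 = j then γ (i + 1) * w (i + 1) else 0) +
        (if (j : ℕ) + 1 = i then γ i * w (i - 1) else 0) := by
    simp only [H0XX, Matrix.of_apply]
    split_ifs with h₁ h₂ h₂
    · omega
    · rw [h₁, add_zero]
    · rw [← h₂, Nat.add_sub_cancel, zero_add]
    · simp
  have hright : ∑ j : Fin N, (if (i : ℕ) + 1 = j then γ (i + 1) * w (i + 1) else 0) =
      if (i : ℕ) + 1 < N then γ (i + 1) * w (i + 1) else 0 := by
    rw [Fin.sum_univ_eq_sum_range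
      (fun j => if (i : ℕ) + 1 = j then γ (i + 1) * w (i + 1) else 0) N]
    simp
  have hleft : ∑ j : Fin N, (if (j : ℕ) + 1 = i then γ i * w (i - 1) else 0) =
      if 0 < (i : ℕ) then γ i * w (i - 1) else 0 := by
    rw [Fin.sum_univ_eq_sum_range
      (fun j => if j + 1 = (i : ℕ) then γ i * w (i - 1) else 0) N]
    obtain ⟨i, hi⟩ := i
    cases i with
    | zero => simp
    | succ n => simp [show n < N by omega]
  simp only [Matrix.mulVec, dotProduct, hentry, Finset.sum_add_distrib, hright, hleft]

/-- An XX chain of odd length (arbitrary nonzero couplings) has a nonzero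
kernel vector whose entries vanish at every even (1-based) index; hence a Z
control at an even-indexed spin always admits an external symmetry on the
single-excitation subspace. -/
theorem stmt_5 (N : ℕ) (hN : 3 ≤ N) (hodd : Odd N) (γ : ℕ → ℝ)
    (hγ : ∀ n, 1 ≤ n → n ≤ N - 1 → γ n ≠ 0) :
    ∃ v : Fin N → ℝ, v ≠ 0 ∧ (H0XX N γ).mulVec v = 0 ∧
      ∀ m : Fin N, Even ((m : ℕ) + 1) → v m = 0 := by
  refine ⟨fun m => zeroMode γ m, fun h => ?_, ?_, fun m hm => ?_⟩
  · have h₀ := congrFun h ⟨0, by omega⟩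
    simp [zeroMode] at h₀
  · funext i
    rw [H0XX_mulVec_apply, Pi.zero_apply]
    obtain ⟨i, hi⟩ := i
    cases i with
    | zero => simp [zeroMode]
    | succ n =>
      by_cases hlast : n + 2 < N
      · have hrec := zeroMode_recurrence γ (hγ (n + 2) (by omega) (by omega))
        rw [add_comm] at hrec
        simpa [hlast, add_assoc] using hrec
      · have hn : Odd n := by
          obtain ⟨k, hk⟩ := hodd
          exact ⟨k - 1, by omega⟩
        simp [hlast, add_assoc, zeroMode_of_odd γ hn]
  · exact zeroMode_of_odd γ (by rwa [Nat.even_add_one, Nat.not_even_iff_odd] at hm)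
end

section
/- The set of real numbers κ for which some uniform XXZ chain whose length is not twice the control index minus one admits an external symmetry is countable. Precisely, the set { κ ∈ ℝ : there exist integers N ≥ 2 and k with 1 ≤ k ≤ N and N ≠ 2k−1, a real λ, and a nonzero v ∈ ℝ^N with H₀(N,κ) v = λ v and v_k = 0 } is countable. -/
open Matrix

/-- Uniform XXZ chain Hamiltonian on the single-excitation subspace (real
form): off-diagonal entries `(H₀)_{m,m+1} = (H₀)_{m+1,m} = 1`, corner diagonal
entries `(H₀)_{1,1} = (H₀)_{N,N} = κ`, all other entries 0. -/
def H0r (N : ℕ) (κ : ℝ) : Matrix (Fin N) (Fin N) ℝ :=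
  Matrix.of fun i j =>
    if (i : ℕ) + 1 = (j : ℕ) ∨ (j : ℕ) + 1 = (i : ℕ) then 1
    else if i = j ∧ ((i : ℕ) = 0 ∨ (i : ℕ) + 1 = N) then κ else 0

open Polynomial in
/-- Entries of the solution of the left boundary condition and the bulk recurrence, normalised to
start at `1`; here `Chebyshev.S ℝ n` is the rescaled Chebyshev polynomial of the second kind. -/
noncomputable def leftSolution (κ lam : ℝ) (n : ℤ) : ℝ :=
  (Chebyshev.S ℝ n).eval lam - κ * (Chebyshev.S ℝ (n - 1)).eval lam

open Polynomial in
lemma eval_chebyshevS_add_two (lam : ℝ) (n : ℤ) :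
    (Chebyshev.S ℝ (n + 2)).eval lam =
      lam * (Chebyshev.S ℝ (n + 1)).eval lam - (Chebyshev.S ℝ n).eval lam := by
  simp [Chebyshev.S_add_two]

lemma leftSolution_zero (κ lam : ℝ) : leftSolution κ lam 0 = 1 := by
  simp [leftSolution]

lemma leftSolution_one (κ lam : ℝ) : leftSolution κ lam 1 = lam - κ := by
  simp [leftSolution]

lemma leftSolution_add_two (κ lam : ℝ) (n : ℤ) :
    leftSolution κ lam (n + 2) = lam * leftSolution κ lam (n + 1) - leftSolution κ lam n := by
  have h := eval_chebyshevS_add_two lam (n - 1)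
  rw [show n - 1 + 2 = n + 1 by ring, show n - 1 + 1 = n by ring] at h
  rw [leftSolution, leftSolution, leftSolution, eval_chebyshevS_add_two,
    show n + 2 - 1 = n + 1 by ring, show n + 1 - 1 = n by ring, h]
  ring

lemma leftSolution_succ_ne_zero {κ lam : ℝ} {n : ℕ} (h : leftSolution κ lam n = 0) :
    leftSolution κ lam (n + 1) ≠ 0 := by
  induction n with
  | zero => simp [leftSolution_zero] at h
  | succ n ih =>
    intro h'
    push_cast at h h'
    rw [add_assoc, one_add_one_eq_two, leftSolution_add_two, h] at h'
    exact ih (by linarith) h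

open Polynomial in
lemma leftSolution_add (κ lam : ℝ) (a : ℤ) (d : ℕ) :
    leftSolution κ lam (a + 1 + d) = leftSolution κ lam (a + 1) * (Chebyshev.S ℝ d).eval lam -
      leftSolution κ lam a * (Chebyshev.S ℝ (d - 1)).eval lam := by
  induction d using Nat.twoStepInduction with
  | zero => simp
  | one =>
    have h := leftSolution_add_two κ lam a
    rw [show a + 2 = a + 1 + (1 : ℕ) by push_cast; ring] at h
    rw [h]
    simp
    ring
  | more d h₀ h₁ =>
    have h := eval_chebyshevS_add_two lam (d - 1)
    rw [show (d : ℤ) - 1 + 2 = d + 1 by ring, show (d : ℤ) - 1 + 1 = d by ring] at h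
    push_cast at h₁ ⊢
    rw [← add_assoc, leftSolution_add_two, h₀,
      show a + 1 + (d : ℤ) + 1 = a + 1 + (d + 1) by ring, h₁, eval_chebyshevS_add_two,
      show (d : ℤ) + 2 - 1 = d + 1 by ring, show (d : ℤ) + 1 - 1 = d by ring, h]
    ring

open Polynomial in
lemma eval_chebyshevS_ne_zero_of_leftSolution_eq_zero {κ lam : ℝ} {n : ℕ}
    (h : leftSolution κ lam n = 0) : (Chebyshev.S ℝ ((n : ℤ) - 1)).eval lam ≠ 0 := by
  intro h₁
  have h₀ : leftSolution 0 lam n = 0 := by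
    simp only [leftSolution, h₁] at h ⊢
    simpa using h
  have h₂ := leftSolution_succ_ne_zero h₀
  have h₃ := leftSolution_add_two 0 lam ((n : ℤ) - 1)
  rw [show (n : ℤ) - 1 + 2 = n + 1 by ring, show (n : ℤ) - 1 + 1 = n by ring, h₀] at h₃
  apply h₂
  rw [h₃, leftSolution, h₁]
  simp

lemma H0r_mulVec_zero {n : ℕ} (κ : ℝ) (v : Fin (n + 2) → ℝ) :
    (H0r (n + 2) κ *ᵥ v) 0 = κ * v 0 + v 1 := by
  rw [mulVec, dotProduct, Fintype.sum_eq_add 0 1 (by simp)]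
  · simp [H0r]
  · rintro j ⟨h₀, h₁⟩
    have h₀' : (j : ℕ) ≠ 0 := fun h => h₀ (Fin.ext h)
    have h₁' : (j : ℕ) ≠ 1 := fun h => h₁ (Fin.ext (by simpa using h))
    simp [H0r, h₀.symm, h₁'.symm]

lemma H0r_mulVec_interior {N m : ℕ} (κ : ℝ) (v : Fin N → ℝ) (h : m + 2 < N) :
    (H0r N κ *ᵥ v) ⟨m + 1, by omega⟩ = v ⟨m, by omega⟩ + v ⟨m + 2, h⟩ := by
  rw [mulVec, dotProduct, Fintype.sum_eq_add ⟨m, by omega⟩ ⟨m + 2, h⟩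
    (by rw [Ne, Fin.mk.injEq]; omega)]
  · simp [H0r]
  · rintro ⟨j, hj⟩ ⟨h₀, h₁⟩
    simp only [ne_eq, Fin.mk.injEq] at h₀ h₁
    have : ¬ (m + 1 + 1 = j ∨ j + 1 = m + 1) := by omega
    have : ¬ (m + 1 = j ∧ (m + 1 = 0 ∨ m + 1 + 1 = N)) := by omega
    simp only [H0r, of_apply, Fin.mk.injEq]
    rw [if_neg ‹_›, if_neg ‹_›, zero_mul]

lemma H0r_rev_rev {N : ℕ} (κ : ℝ) (i j : Fin N) : H0r N κ i.rev j.rev = H0r N κ i j := by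
  have hi := i.isLt
  have hj := j.isLt
  simp only [H0r, of_apply, Fin.val_rev, Fin.rev_inj]
  congr 1
  · apply propext; omega
  · congr 1
    apply propext
    exact and_congr_right fun _ => by omega

/-- Reflection of the chain preserves eigenvectors. -/
lemma H0r_mulVec_comp_rev {N : ℕ} {κ lam : ℝ} {v : Fin N → ℝ}
    (h : H0r N κ *ᵥ v = lam • v) : H0r N κ *ᵥ (v ∘ Fin.rev) = lam • (v ∘ Fin.rev) := by
  ext i
  have hi := congrFun h i.rev
  simp only [mulVec, dotProduct, Pi.smul_apply, Function.comp_apply] at hi ⊢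
  rw [← hi, ← Equiv.sum_comp Fin.revPerm]
  simp only [Fin.revPerm_apply, Fin.rev_rev]
  exact Finset.sum_congr rfl fun j _ => by rw [← H0r_rev_rev, Fin.rev_rev]

lemma eigenvector_apply {n : ℕ} {κ lam : ℝ} {v : Fin (n + 2) → ℝ}
    (h : H0r (n + 2) κ *ᵥ v = lam • v) (m : ℕ) (hm : m < n + 2) :
    v ⟨m, hm⟩ = v 0 * leftSolution κ lam m := by
  induction m using Nat.twoStepInduction with
  | zero => simp [leftSolution_zero]
  | one =>
    have h₀ := congrFun h 0
    rw [H0r_mulVec_zero, Pi.smul_apply, smul_eq_mul] at h₀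
    rw [Nat.cast_one, leftSolution_one, show (⟨1, hm⟩ : Fin (n + 2)) = 1 from rfl]
    linarith
  | more m ih₀ ih₁ =>
    have hr := congrFun h ⟨m + 1, by omega⟩
    rw [H0r_mulVec_interior κ v hm, Pi.smul_apply, smul_eq_mul, ih₀, ih₁] at hr
    push_cast at hr ⊢
    rw [leftSolution_add_two]
    linarith

lemma leftSolution_eq_zero_of_eigenvector {N m : ℕ} {κ lam : ℝ} {v : Fin N → ℝ} (hN : 2 ≤ N)
    (hv : v ≠ 0) (h : H0r N κ *ᵥ v = lam • v) (hm : m < N) (hvm : v ⟨m, hm⟩ = 0) :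
    leftSolution κ lam m = 0 := by
  obtain ⟨n, rfl⟩ := Nat.exists_eq_add_of_le' hN
  have hv0 : v 0 ≠ 0 := fun h₀ => hv <| funext fun i => by
    simpa [h₀] using eigenvector_apply h i i.isLt
  rw [eigenvector_apply h] at hvm
  exact (mul_eq_zero.mp hvm).resolve_left hv0

open Polynomial in
lemma chebyshevS_natCast_ne_zero (d : ℕ) : Chebyshev.S ℝ (d : ℤ) ≠ 0 := by
  intro h
  have h₂ := congrArg (Polynomial.eval 2) h
  rw [Chebyshev.S_eval_two] at h₂
  simp only [eval_zero] at h₂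
  norm_cast at h₂

open Polynomial in
/-- If the left solution vanishes at two different sites, then `κ` is a ratio of Chebyshev values
at a root of a Chebyshev polynomial. -/
lemma exists_mem_image_of_leftSolution_eq_zero {κ lam : ℝ} {a b : ℕ} (hab : a < b)
    (ha : leftSolution κ lam a = 0) (hb : leftSolution κ lam b = 0) :
    ∃ d : ℕ, κ ∈ (fun x : ℝ => (Chebyshev.S ℝ (a : ℤ)).eval x /
      (Chebyshev.S ℝ ((a : ℤ) - 1)).eval x) '' {x | (Chebyshev.S ℝ (d : ℤ)).IsRoot x} := by
  obtain ⟨d, rfl⟩ := Nat.exists_eq_add_of_lt hab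
  refine ⟨d, lam, ?_, ?_⟩
  · have h := leftSolution_add κ lam a d
    rw [show (a : ℤ) + 1 + d = ((a + d + 1 : ℕ) : ℤ) by push_cast; ring, hb, ha, zero_mul,
      sub_zero] at h
    exact (mul_eq_zero.mp h.symm).resolve_left (leftSolution_succ_ne_zero ha)
  · rw [div_eq_iff (eval_chebyshevS_ne_zero_of_leftSolution_eq_zero ha)]
    exact sub_eq_zero.mp ha

/-- The set of anisotropy parameters `κ` for which some uniform XXZ chain
(excluding the trivial case `N = 2k-1`) admits an external symmetry — i.e. an
eigenvector of `H₀(N,κ)` with vanishing k-th entry — is countable. -/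
theorem stmt_7 :
    Set.Countable { κ : ℝ | ∃ (N k : ℕ) (_ : 2 ≤ N) (_ : 1 ≤ k) (_ : k ≤ N),
      N ≠ 2 * k - 1 ∧ ∃ (lam : ℝ) (v : Fin N → ℝ), v ≠ 0 ∧
        (H0r N κ).mulVec v = lam • v ∧ v ⟨k - 1, by omega⟩ = 0 } := by
  refine Set.Countable.mono ?_ (Set.countable_iUnion fun a : ℕ => Set.countable_iUnion fun d : ℕ =>
    ((Polynomial.finite_setOfPred_isRoot (chebyshevS_natCast_ne_zero d)).image fun x : ℝ =>
      (Polynomial.Chebyshev.S ℝ (a : ℤ)).eval x /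
        (Polynomial.Chebyshev.S ℝ ((a : ℤ) - 1)).eval x).countable)
  rintro κ ⟨N, k, hN, hk, hkN, hne, lam, v, hv, h, hvk⟩
  have hl := leftSolution_eq_zero_of_eigenvector hN hv h (by omega) hvk
  have hr : leftSolution κ lam (N - k : ℕ) = 0 := by
    refine leftSolution_eq_zero_of_eigenvector hN (fun h₀ => hv ?_) (H0r_mulVec_comp_rev h)
      (by omega) ?_
    · exact funext fun i => by simpa using congrFun h₀ i.rev
    · rw [← hvk, Function.comp_apply]
      congr 1
      ext
      simp only [Fin.val_rev]
      omega
  simp only [Set.mem_iUnion]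
  rcases lt_or_gt_of_ne (show k - 1 ≠ N - k by omega) with hlt | hlt
  · exact ⟨_, exists_mem_image_of_leftSolution_eq_zero hlt hl hr⟩
  · exact ⟨_, exists_mem_image_of_leftSolution_eq_zero hlt hr hl⟩
end

section
/- Let N ≥ 2, κ ∈ ℝ, and let P be the N×N diagonal matrix with P_{mm} = (−1)^{m−1}. If v ∈ ℝ^N satisfies H₀(N,κ) v = E v for some E ∈ ℝ, then H₀(N,−κ) (P v) = −E (P v). Consequently, for every k with 1 ≤ k ≤ N, the matrix H₀(N,κ) has a nonzero eigenvector with vanishing k-th entry if and only if H₀(N,−κ) does; i.e. uniform homogeneous XXZ chains with opposite values of κ have the same external symmetries. -/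
open Matrix

/-- Conjugation by the alternating sign matrix turns `H₀(N,κ)` into `-H₀(N,-κ)`. -/
theorem H0r_neg_mul_sign (N : ℕ) (κ : ℝ) (i j : Fin N) :
    H0r N (-κ) i j * (-1 : ℝ) ^ (j : ℕ) = -((-1 : ℝ) ^ (i : ℕ) * H0r N κ i j) := by
  simp only [H0r, Matrix.of_apply]
  split_ifs with hadj hdiag
  · rcases hadj with h | h <;> rw [← h, pow_succ] <;> ring
  · rw [hdiag.1]
    ring
  · ring

theorem H0r_neg_mulVec_sign (N : ℕ) (κ : ℝ) (v : Fin N → ℝ) (E : ℝ)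
    (hv : (H0r N κ).mulVec v = E • v) :
    (H0r N (-κ)).mulVec
        ((Matrix.diagonal fun m : Fin N => (-1 : ℝ) ^ (m : ℕ)).mulVec v)
      = (-E) • ((Matrix.diagonal fun m : Fin N => (-1 : ℝ) ^ (m : ℕ)).mulVec v) := by
  ext i
  have hi : ∑ j, H0r N κ i j * v j = E * v i := congrFun hv i
  simp only [Matrix.mulVec_diagonal, Pi.smul_apply, smul_eq_mul]
  calc ∑ j, H0r N (-κ) i j * (Matrix.diagonal fun m : Fin N => (-1 : ℝ) ^ (m : ℕ)).mulVec v j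
      = ∑ j, -(-1 : ℝ) ^ (i : ℕ) * (H0r N κ i j * v j) := by
        refine Finset.sum_congr rfl fun j _ => ?_
        rw [Matrix.mulVec_diagonal, ← mul_assoc, H0r_neg_mul_sign]
        ring
    _ = -E * ((-1 : ℝ) ^ (i : ℕ) * v i) := by
        rw [← Finset.mul_sum, hi]
        ring

theorem exists_eigenvector_H0r_neg (N : ℕ) (κ : ℝ) (k : Fin N)
    (h : ∃ (lam : ℝ) (v : Fin N → ℝ), v ≠ 0 ∧ (H0r N κ).mulVec v = lam • v ∧ v k = 0) :
    ∃ (lam : ℝ) (v : Fin N → ℝ), v ≠ 0 ∧ (H0r N (-κ)).mulVec v = lam • v ∧ v k = 0 := by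
  obtain ⟨E, v, hv0, hv, hk⟩ := h
  refine ⟨-E, _, fun h0 => hv0 ?_, H0r_neg_mulVec_sign N κ v E hv, ?_⟩
  · ext i
    simpa [Matrix.mulVec_diagonal] using congrFun h0 i
  · simp [Matrix.mulVec_diagonal, hk]

/-- With `P = diag((-1)^{m-1})`, if `H₀(N,κ) v = E v` then
`H₀(N,-κ) (P v) = -E (P v)`; consequently uniform XXZ chains with opposite
values of `κ` have the same external symmetries. -/
theorem stmt_8 (N : ℕ) (hN : 2 ≤ N) (κ : ℝ) :
    (∀ (v : Fin N → ℝ) (E : ℝ), (H0r N κ).mulVec v = E • v →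
      (H0r N (-κ)).mulVec
          ((Matrix.diagonal fun m : Fin N => (-1 : ℝ) ^ (m : ℕ)).mulVec v)
        = (-E) • ((Matrix.diagonal fun m : Fin N => (-1 : ℝ) ^ (m : ℕ)).mulVec v)) ∧
    (∀ k : ℕ, ∀ _ : 1 ≤ k, ∀ _ : k ≤ N,
      ((∃ (lam : ℝ) (v : Fin N → ℝ), v ≠ 0 ∧
          (H0r N κ).mulVec v = lam • v ∧ v ⟨k - 1, by omega⟩ = 0) ↔
       (∃ (lam : ℝ) (v : Fin N → ℝ), v ≠ 0 ∧
          (H0r N (-κ)).mulVec v = lam • v ∧ v ⟨k - 1, by omega⟩ = 0))) := by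
  refine ⟨H0r_neg_mulVec_sign N κ, fun k _ _ => ⟨exists_eigenvector_H0r_neg N κ _, fun h => ?_⟩⟩
  simpa using exists_eigenvector_H0r_neg N (-κ) _ h
end

section
/- Let N ≥ 2 and 1 ≤ k ≤ N, and let H₀(N,0) be the uniform XX chain Hamiltonian. Then there exist λ ∈ ℝ and a nonzero v ∈ ℝ^N with H₀(N,0) v = λ v and v_k = 0 if and only if gcd(N+1, k) > 1. That is, a uniform XX chain with a Z control on spin k has an external symmetry on the single-excitation subspace exactly when N+1 and k have a common divisor greater than 1. -/
open Matrix

/-- The generalized Fibonacci sequence `0, 1, x, x ^ 2 - 1, …` (shifted rescaled Chebyshev values). -/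
noncomputable def chebyshevSeq (x : ℝ) : ℕ → ℝ
  | 0 => 0
  | 1 => 1
  | n + 2 => x * chebyshevSeq x (n + 1) - chebyshevSeq x n

theorem chebyshevSeq_add (x : ℝ) (m n : ℕ) :
    chebyshevSeq x (m + n + 1) =
      chebyshevSeq x (m + 1) * chebyshevSeq x (n + 1) - chebyshevSeq x m * chebyshevSeq x n := by
  induction m generalizing n with
  | zero => simp [chebyshevSeq]
  | succ m ih =>
    rw [show m + 1 + n + 1 = m + (n + 1) + 1 by ring, ih (n + 1)]
    simp only [chebyshevSeq]
    ring

theorem chebyshevSeq_succ_ne_zero {x : ℝ} {n : ℕ} (h : chebyshevSeq x n = 0) :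
    chebyshevSeq x (n + 1) ≠ 0 := by
  induction n with
  | zero => simp [chebyshevSeq]
  | succ n ih =>
    intro h'
    refine ih ?_ h
    simpa [chebyshevSeq, h] using h'

theorem chebyshevSeq_add_eq_zero_iff {x : ℝ} {a : ℕ} (ha : chebyshevSeq x a = 0) (b : ℕ) :
    chebyshevSeq x (a + b) = 0 ↔ chebyshevSeq x b = 0 := by
  cases b with
  | zero => simp [ha, chebyshevSeq]
  | succ b =>
    rw [← add_assoc, chebyshevSeq_add, ha]
    simp [chebyshevSeq_succ_ne_zero ha]

theorem chebyshevSeq_mod_eq_zero {x : ℝ} {a : ℕ} (ha : chebyshevSeq x a = 0) (b : ℕ)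
    (hb : chebyshevSeq x b = 0) : chebyshevSeq x (b % a) = 0 := by
  have key (q r : ℕ) : chebyshevSeq x (a * q + r) = 0 ↔ chebyshevSeq x r = 0 := by
    induction q with
    | zero => simp
    | succ q ih =>
      rw [show a * (q + 1) + r = a + (a * q + r) by ring, chebyshevSeq_add_eq_zero_iff ha, ih]
  rwa [← key (b / a), Nat.div_add_mod]

theorem chebyshevSeq_gcd_eq_zero {x : ℝ} (a b : ℕ) (ha : chebyshevSeq x a = 0)
    (hb : chebyshevSeq x b = 0) : chebyshevSeq x (Nat.gcd a b) = 0 := by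
  induction a, b using Nat.gcd.induction with
  | H0 b => simpa using hb
  | H1 a b _ ih =>
    rw [Nat.gcd_rec]
    exact ih (chebyshevSeq_mod_eq_zero ha b hb) ha

theorem eq_mul_chebyshevSeq {x : ℝ} {u : ℕ → ℝ} {N : ℕ} (h0 : u 0 = 0)
    (hu : ∀ i < N, u i + u (i + 2) = x * u (i + 1)) (n : ℕ) (hn : n ≤ N + 1) :
    u n = u 1 * chebyshevSeq x n := by
  induction n using Nat.twoStepInduction with
  | zero => simp [h0, chebyshevSeq]
  | one => simp [chebyshevSeq]
  | more n ih₁ ih₂ =>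
    have h₁ := ih₁ (by omega)
    have h₂ := ih₂ (by omega)
    have h := hu n (by omega)
    simp only [chebyshevSeq]
    linear_combination h - h₁ + x * h₂

theorem H0r_zero_mulVec {N : ℕ} {u : ℕ → ℝ} (h0 : u 0 = 0) (hN : u (N + 1) = 0) (i : Fin N) :
    (H0r N 0).mulVec (fun j => u (j + 1)) i = u i + u (i + 2) := by
  obtain ⟨i, hi⟩ := i
  have hsum : (H0r N 0).mulVec (fun j => u (j + 1)) ⟨i, hi⟩ =
      ∑ j ∈ Finset.range N,
        ((if j + 1 = i then u (j + 1) else 0) + if i + 1 = j then u (j + 1) else 0) := by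
    rw [← Fin.sum_univ_eq_sum_range
      (fun j => (if j + 1 = i then u (j + 1) else 0) + if i + 1 = j then u (j + 1) else 0)]
    rw [Matrix.mulVec, dotProduct]
    refine Finset.sum_congr rfl fun j _ => ?_
    simp only [H0r, Matrix.of_apply, ite_self]
    split_ifs <;> first | omega | simp
  rw [hsum, Finset.sum_add_distrib]
  congr 1
  · cases i with
    | zero => simp [h0]
    | succ i => simp [show i < N by omega]
  · rw [Finset.sum_ite_eq]
    split_ifs with h
    · rfl
    · rw [Finset.mem_range] at h
      rw [show i + 2 = N + 1 by omega, hN]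

theorem sin_natCast_mul_pi_div_eq_zero {d n : ℕ} (hd : d ≠ 0) (h : d ∣ n) :
    Real.sin (n * (Real.pi / d)) = 0 := by
  obtain ⟨c, rfl⟩ := h
  have hd' : (d : ℝ) ≠ 0 := by exact_mod_cast hd
  rw [show ((d * c : ℕ) : ℝ) * (Real.pi / d) = c * Real.pi by push_cast; field_simp]
  exact Real.sin_nat_mul_pi c

/-- A uniform XX chain has an eigenvector with vanishing k-th entry (an
external symmetry for a Z control on spin k) iff `gcd(N+1, k) > 1`. -/
theorem stmt_9 (N k : ℕ) (hN : 2 ≤ N) (hk1 : 1 ≤ k) (hkN : k ≤ N) :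
    (∃ (lam : ℝ) (v : Fin N → ℝ), v ≠ 0 ∧
        (H0r N 0).mulVec v = lam • v ∧ v ⟨k - 1, by omega⟩ = 0) ↔
    1 < Nat.gcd (N + 1) k := by
  constructor
  · rintro ⟨x, v, hv, hev, hvk⟩
    let u : ℕ → ℝ := fun n => if h : 1 ≤ n ∧ n ≤ N then v ⟨n - 1, by omega⟩ else 0
    have h0 : u 0 = 0 := by simp [u]
    have hN1 : u (N + 1) = 0 := by simp [u]
    have huv : (fun j : Fin N => u (j + 1)) = v := by
      funext j
      simp [u, Nat.succ_le_iff]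
    have hu (i : ℕ) (hi : i < N) : u i + u (i + 2) = x * u (i + 1) := by
      rw [← H0r_zero_mulVec h0 hN1 ⟨i, hi⟩, huv, hev, ← huv]
      rfl
    have hmul := eq_mul_chebyshevSeq h0 hu
    have h1 : u 1 ≠ 0 := by
      intro h1
      refine hv (funext fun j => ?_)
      rw [← huv]
      change u (j + 1) = 0
      rw [hmul _ (by omega), h1, zero_mul]
    have huk : u k = 0 := by simpa [u, hk1, hkN] using hvk
    have hzero {n : ℕ} (hn : n ≤ N + 1) (h : u n = 0) : chebyshevSeq x n = 0 := by
      rw [hmul n hn] at h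
      exact (mul_eq_zero.mp h).resolve_left h1
    have hgcd := chebyshevSeq_gcd_eq_zero _ _ (hzero le_rfl hN1) (hzero (by omega) huk)
    have hpos : 0 < Nat.gcd (N + 1) k := Nat.gcd_pos_of_pos_left _ (by omega)
    refine lt_of_le_of_ne hpos fun h => ?_
    rw [← h] at hgcd
    simp [chebyshevSeq] at hgcd
  · intro hd
    set d := Nat.gcd (N + 1) k
    set θ := Real.pi / (d : ℝ) with hθ
    let u : ℕ → ℝ := fun n => Real.sin (n * θ)
    have hd0 : d ≠ 0 := by omega
    have h0 : u 0 = 0 := by simp [u]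
    have hN1 : u (N + 1) = 0 := sin_natCast_mul_pi_div_eq_zero hd0 (Nat.gcd_dvd_left _ _)
    have hu1 : 0 < u 1 := by
      have hd1 : (1 : ℝ) < d := by exact_mod_cast hd
      simp only [u, Nat.cast_one, one_mul]
      exact Real.sin_pos_of_pos_of_lt_pi (by positivity) (div_lt_self Real.pi_pos hd1)
    refine ⟨2 * Real.cos θ, fun j => u (j + 1), fun h => ?_, funext fun i => ?_, ?_⟩
    · exact hu1.ne' (congrFun h ⟨0, by omega⟩)
    · rw [H0r_zero_mulVec h0 hN1]
      simp only [u, Pi.smul_apply, smul_eq_mul]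
      push_cast
      rw [show (i : ℝ) * θ = (i + 1) * θ - θ by ring,
        show ((i : ℝ) + 2) * θ = (i + 1) * θ + θ by ring, Real.sin_sub, Real.sin_add]
      ring
    · change u (k - 1 + 1) = 0
      rw [Nat.sub_add_cancel hk1]
      exact sin_natCast_mul_pi_div_eq_zero hd0 (Nat.gcd_dvd_right _ _)
end

section
/- Let N ≥ 2 and 1 ≤ k ≤ N, and let H₀(N,1) be the uniform Heisenberg chain Hamiltonian. Then there exist λ ∈ ℝ and a nonzero v ∈ ℝ^N with H₀(N,1) v = λ v and v_k = 0 if and only if gcd(N, 2k−1) > 1. That is, a uniform Heisenberg chain with a Z control on spin k has an external symmetry on the single-excitation subspace exactly when N and 2k−1 have a common divisor greater than 1. -/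
open Matrix

/-- A two-sided solution of `f (j + 1) + f (j - 1) = c * f j` with two consecutive zeros vanishes. -/
theorem eq_zero_of_recurrence {c : ℝ} {f : ℤ → ℝ} (hf : ∀ j, f (j + 1) + f (j - 1) = c * f j)
    (a : ℤ) (h₀ : f a = 0) (h₁ : f (a + 1) = 0) (j : ℤ) : f j = 0 := by
  suffices h : ∀ i : ℤ, f (a + i) = 0 ∧ f (a + i + 1) = 0 by
    simpa using (h (j - a)).1
  intro i
  induction i with
  | zero => simpa using ⟨h₀, h₁⟩
  | succ n ih =>
    have h := hf (a + n + 1)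
    rw [ih.2, show a + (n : ℤ) + 1 - 1 = a + n by ring, ih.1] at h
    rw [← add_assoc]
    exact ⟨ih.2, by linarith⟩
  | pred n ih =>
    have h := hf (a + -n)
    rw [ih.1, ih.2] at h
    rw [show a + (-(n : ℤ) - 1) = a + -n - 1 by ring, sub_add_cancel]
    exact ⟨by linarith, ih.1⟩

/-- Two solutions of the recurrence that agree at two consecutive places are equal. -/
theorem eq_of_recurrence {c : ℝ} {f g : ℤ → ℝ} (hf : ∀ j, f (j + 1) + f (j - 1) = c * f j)
    (hg : ∀ j, g (j + 1) + g (j - 1) = c * g j) (a : ℤ) (h₀ : f a = g a)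
    (h₁ : f (a + 1) = g (a + 1)) (j : ℤ) : f j = g j := by
  refine sub_eq_zero.1 (eq_zero_of_recurrence (c := c) (f := fun i => f i - g i) (fun i => ?_) a
    (sub_eq_zero.2 h₀) (sub_eq_zero.2 h₁) j)
  linear_combination hf i - hg i

theorem recurrence_comp_sub {c : ℝ} {f : ℤ → ℝ} (hf : ∀ j, f (j + 1) + f (j - 1) = c * f j)
    (a j : ℤ) : f (a - (j + 1)) + f (a - (j - 1)) = c * f (a - j) := by
  rw [← hf, show a - (j + 1) = a - j - 1 by ring, show a - (j - 1) = a - j + 1 by ring, add_comm]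

/-- A solution of the recurrence that is even about `-1/2` and `N - 1/2` and vanishes at `p` is
identically zero if `N` and `2 * p + 1` are coprime. -/
theorem eq_zero_of_isCoprime {c : ℝ} {f : ℤ → ℝ} (hf : ∀ j, f (j + 1) + f (j - 1) = c * f j)
    {N p : ℤ} (hleft : f (-1) = f 0) (hright : f N = f (N - 1)) (hp : f p = 0)
    (hcop : IsCoprime N (2 * p + 1)) (j : ℤ) : f j = 0 := by
  have even_left (i : ℤ) : f (-1 - i) = f i :=
    eq_of_recurrence (f := fun i => f (_ - i)) (recurrence_comp_sub hf _) hf (-1)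
      (by simpa using hleft.symm) (by simpa using hleft) i
  have even_right (i : ℤ) : f (2 * N - 1 - i) = f i :=
    eq_of_recurrence (f := fun i => f (_ - i)) (recurrence_comp_sub hf _) hf (N - 1)
      (by rw [← hright]; congr 1; ring)
      (by rw [sub_add_cancel, hright]; congr 1; ring) i
  have odd_p (i : ℤ) : f (2 * p - i) = -f i := by
    refine eq_of_recurrence (f := fun i => f (_ - i)) (g := fun i => -f i)
      (recurrence_comp_sub hf _)
      (fun i => by linear_combination -hf i) p ?_ ?_ i
    · rw [show 2 * p - p = p by ring, hp, neg_zero]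
    · have h := hf p
      rw [show 2 * p - (p + 1) = p - 1 by ring]
      rw [hp] at h
      linarith
  have anti : Function.Antiperiodic f (2 * p + 1) := fun i => by
    rw [← even_left i, ← odd_p]
    congr 1
    ring
  have per : Function.Periodic f (2 * N) := fun i => by
    rw [← even_right, ← even_left i]
    congr 1
    ring
  have per_two : Function.Periodic f 2 := by
    obtain ⟨a, b, hab⟩ := hcop
    rw [show (2 : ℤ) = a * (2 * N) + b * (2 * (2 * p + 1)) by linear_combination -2 * hab]
    exact (per.int_mul a).add_period (anti.periodic_two_mul.int_mul b)
  have anti_one : Function.Antiperiodic f 1 := fun i => by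
    rw [← anti, ← per_two.int_mul p (i + 1), Int.cast_id]
    congr 1
    ring
  have hzero : f 0 = 0 := by
    have h := anti_one (-1)
    rw [neg_add_cancel, hleft] at h
    linarith
  refine eq_zero_of_recurrence hf 0 hzero ?_ j
  rw [anti_one, hzero, neg_zero]

theorem H0r_one_mulVec {N : ℕ} (hN : 2 ≤ N) (V : ℕ → ℝ) (i : Fin N) :
    (H0r N 1).mulVec (fun j => V j) i =
      (if (i : ℕ) = 0 then V i else V (i - 1)) + (if (i : ℕ) + 1 = N then V i else V (i + 1)) := by
  obtain ⟨i, hi⟩ := i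
  have h : (H0r N 1).mulVec (fun j => V j) ⟨i, hi⟩ = ∑ j ∈ Finset.range N,
      ((if j = (if i = 0 then i else i - 1) then V j else 0) +
        (if j = (if i + 1 = N then i else i + 1) then V j else 0)) := by
    rw [← Fin.sum_univ_eq_sum_range (fun j => (if j = (if i = 0 then i else i - 1) then V j else 0) +
      (if j = (if i + 1 = N then i else i + 1) then V j else 0))]
    simp only [Matrix.mulVec, dotProduct]
    refine Finset.sum_congr rfl fun j _ => ?_
    simp only [H0r, Matrix.of_apply, Fin.ext_iff]
    split_ifs <;> first | omega | simp
  rw [h, Finset.sum_add_distrib, Finset.sum_ite_eq', Finset.sum_ite_eq']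
  simp only [Finset.mem_range]
  split_ifs <;> first | omega | rfl

/-- An eigenvector of the Heisenberg chain extends to a two-sided solution of the recurrence that
is even about both ends of the chain. -/
theorem exists_recurrence_of_eigenvector {N : ℕ} (hN : 2 ≤ N) {c : ℝ} {v : Fin N → ℝ}
    (hv : (H0r N 1).mulVec v = c • v) :
    ∃ f : ℤ → ℝ, (∀ j, f (j + 1) + f (j - 1) = c * f j) ∧ f (-1) = f 0 ∧
      f N = f (N - 1) ∧ ∀ i : Fin N, v i = f (i : ℕ) := by
  obtain ⟨V, rfl⟩ : ∃ V : ℕ → ℝ, v = fun i : Fin N => V i :=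
    ⟨fun m => if h : m < N then v ⟨m, h⟩ else 0, by ext i; simp⟩
  have row (i : ℕ) (hi : i < N) : (if i = 0 then V i else V (i - 1)) +
      (if i + 1 = N then V i else V (i + 1)) = c * V i := by
    rw [← H0r_one_mulVec hN V ⟨i, hi⟩, hv]
    rfl
  let f : ℤ → ℝ := fun j =>
    V 0 * ((Polynomial.Chebyshev.S ℝ j).eval c - (Polynomial.Chebyshev.S ℝ (j - 1)).eval c)
  have rec_S (j : ℤ) : (Polynomial.Chebyshev.S ℝ (j + 1)).eval c +
      (Polynomial.Chebyshev.S ℝ (j - 1)).eval c = c * (Polynomial.Chebyshev.S ℝ j).eval c := by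
    rw [Polynomial.Chebyshev.S_eq ℝ (j + 1)]
    simp [show j + 1 - 2 = j - 1 by ring]
  have hf (j : ℤ) : f (j + 1) + f (j - 1) = c * f j := by
    have h := rec_S (j - 1)
    simp only [sub_add_cancel] at h
    simp only [f, add_sub_cancel_right]
    linear_combination V 0 * (rec_S j - h)
  have f_zero : f 0 = V 0 := by simp [f]
  have f_neg_one : f (-1) = V 0 := by simp [f]
  have hVf (m : ℕ) (hm : m + 1 < N) : V m = f m ∧ V (m + 1) = f (m + 1) := by
    induction m with
    | zero =>
      have h := row 0 (by omega)
      have h' := hf 0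
      rw [if_pos rfl, if_neg (by omega)] at h
      simp only [zero_sub] at h'
      rw [f_neg_one, f_zero] at h'
      refine ⟨by simp [f_zero], ?_⟩
      simp only [Nat.cast_zero]
      linarith
    | succ m ih =>
      obtain ⟨h₀, h₁⟩ := ih (by omega)
      have h := row (m + 1) (by omega)
      rw [if_neg (by omega), if_neg (by omega), Nat.add_sub_cancel, h₀, h₁] at h
      have h' := hf (m + 1)
      rw [add_sub_cancel_right] at h'
      push_cast
      exact ⟨h₁, by linarith⟩
  obtain ⟨n, rfl⟩ : ∃ n, N = n + 2 := ⟨N - 2, by omega⟩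
  refine ⟨f, hf, by rw [f_neg_one, f_zero], ?_, fun i => ?_⟩
  · obtain ⟨h₀, h₁⟩ := hVf n (by omega)
    have h := row (n + 1) (by omega)
    rw [if_neg (by omega), if_pos rfl, Nat.add_sub_cancel, h₀, h₁] at h
    have h' := hf (n + 1)
    rw [add_sub_cancel_right] at h'
    push_cast
    rw [show (n : ℤ) + 2 - 1 = n + 1 by ring, show (n : ℤ) + 2 = n + 1 + 1 by ring]
    linarith
  · obtain ⟨i, hi⟩ := i
    rcases Nat.lt_or_ge (i + 1) (n + 2) with h | h
    · exact (hVf i h).1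
    · obtain rfl : i = n + 1 := by omega
      simpa using (hVf n (by omega)).2

/-- The standing wave with angle `θ` is an eigenvector of the Heisenberg chain as soon as it
satisfies the boundary condition at the right end. -/
theorem H0r_one_mulVec_cos {N : ℕ} (hN : 2 ≤ N) {θ : ℝ} (hθ : Real.sin (2 * N * θ) = 0) :
    (H0r N 1).mulVec (fun j => Real.cos ((2 * (j : ℕ) + 1) * θ)) =
      (2 * Real.cos (2 * θ)) • fun j : Fin N => Real.cos ((2 * (j : ℕ) + 1) * θ) := by
  ext i
  rw [H0r_one_mulVec hN (fun j => Real.cos ((2 * (j : ℕ) + 1) * θ))]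
  obtain ⟨i, hi⟩ := i
  have left : (if i = 0 then Real.cos ((2 * (i : ℝ) + 1) * θ)
      else Real.cos ((2 * ((i - 1 : ℕ) : ℝ) + 1) * θ)) =
        Real.cos ((2 * (i : ℝ) + 1) * θ - 2 * θ) := by
    split_ifs with h
    · subst h
      rw [← Real.cos_neg]
      congr 1
      push_cast
      ring
    · rw [Nat.cast_sub (by omega)]
      congr 1
      push_cast
      ring
  have right : (if i + 1 = N then Real.cos ((2 * (i : ℝ) + 1) * θ)
      else Real.cos ((2 * ((i + 1 : ℕ) : ℝ) + 1) * θ)) =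
        Real.cos ((2 * (i : ℝ) + 1) * θ + 2 * θ) := by
    split_ifs with h
    · subst h
      rw [show (2 * (i : ℝ) + 1) * θ = 2 * ((i + 1 : ℕ) : ℝ) * θ - θ by push_cast; ring,
        show 2 * ((i + 1 : ℕ) : ℝ) * θ - θ + 2 * θ = 2 * ((i + 1 : ℕ) : ℝ) * θ + θ by ring,
        Real.cos_sub, Real.cos_add, hθ]
      ring
    · congr 1
      push_cast
      ring
  simp only [Pi.smul_apply, smul_eq_mul]
  rw [left, right, Real.cos_sub, Real.cos_add]
  ring

/-- A uniform Heisenberg chain has an eigenvector with vanishing k-th entry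
(an external symmetry for a Z control on spin k) iff `gcd(N, 2k-1) > 1`. -/
theorem stmt_10 (N k : ℕ) (hN : 2 ≤ N) (hk1 : 1 ≤ k) (hkN : k ≤ N) :
    (∃ (lam : ℝ) (v : Fin N → ℝ), v ≠ 0 ∧
        (H0r N 1).mulVec v = lam • v ∧ v ⟨k - 1, by omega⟩ = 0) ↔
    1 < Nat.gcd N (2 * k - 1) := by
  constructor
  · rintro ⟨c, v, hv₀, hv, hvk⟩
    by_contra hgcd
    have hcop : Nat.Coprime N (2 * k - 1) :=
      le_antisymm (not_lt.1 hgcd) (Nat.gcd_pos_of_pos_left _ (by omega))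
    obtain ⟨f, hf, hleft, hright, hvf⟩ := exists_recurrence_of_eigenvector hN hv
    refine hv₀ (funext fun i => ?_)
    rw [hvf]
    refine eq_zero_of_isCoprime hf hleft hright ((hvf _).symm.trans hvk) ?_ _
    have h := Nat.isCoprime_iff_coprime.2 hcop
    convert h using 1
    push_cast [hk1, show 1 ≤ 2 * k by omega]
    ring
  · intro hgcd
    obtain ⟨a, ha⟩ := Nat.gcd_dvd_left N (2 * k - 1)
    obtain ⟨b, hb⟩ := Nat.gcd_dvd_right N (2 * k - 1)
    generalize Nat.gcd N (2 * k - 1) = d at hgcd ha hb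
    have hd : (d : ℝ) ≠ 0 := by positivity
    refine ⟨2 * Real.cos (2 * (Real.pi / (2 * d))),
      fun j => Real.cos ((2 * (j : ℕ) + 1) * (Real.pi / (2 * d))), fun h => ?_,
      H0r_one_mulVec_cos hN ?_, ?_⟩
    · have h₀ := congrFun h ⟨0, by omega⟩
      simp only [Nat.cast_zero, mul_zero, zero_add, one_mul, Pi.zero_apply] at h₀
      refine (Real.cos_pos_of_mem_Ioo ⟨?_, ?_⟩).ne' h₀
      · have := Real.pi_pos
        have : 0 < Real.pi / (2 * d) := by positivity
        linarith
      · have : (1 : ℝ) < d := by exact_mod_cast hgcd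
        exact div_lt_div_of_pos_left Real.pi_pos two_pos (by linarith)
    · have hN' : (N : ℝ) = d * a := by exact_mod_cast ha
      rw [hN', show 2 * ((d : ℝ) * a) * (Real.pi / (2 * d)) = a * Real.pi by field_simp]
      exact Real.sin_nat_mul_pi a
    · have hodd : Odd b := by
        have : Odd (d * b) := hb ▸ ⟨k - 1, by omega⟩
        exact (Nat.odd_mul.1 this).2
      obtain ⟨m, rfl⟩ := hodd
      refine Real.cos_eq_zero_iff.2 ⟨m, ?_⟩
      have h : 2 * ((k - 1 : ℕ) : ℝ) + 1 = d * (2 * m + 1) := by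
        exact_mod_cast (show 2 * (k - 1) + 1 = 2 * k - 1 by omega).trans hb
      simp only [h]
      push_cast
      field_simp
end
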